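/- Let A and U be Hopf algebras over a field k and let τ be an invertible skew pairing on (A,U), with convolution inverse τ⁻¹(a,u) = τ(S(a),u). Then the quantum double A ⋈_τ U is a Hopf algebra: the multiplication (a⊗u)(b⊗v) = Σ τ(b₁,u₁) ab₂ ⊗ u₂v τ⁻¹(b₃,u₃) is associative with unit 1⊗1, the tensor-product coalgebra structure on A ⊗ U makes it a bialgebra, and the map a⊗u ↦ (1⊗S(u))·(S(a)⊗1) (product taken in A ⋈_τ U) is an antipode for it. -/

import Mathlib

/-!
STATEMENT 2: The quantum double A ⋈_τ U is a Hopf algebra: the multiplication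
(a⊗u)(b⊗v) = Σ τ(b₁,u₁) ab₂ ⊗ u₂v τ⁻¹(b₃,u₃) is associative with unit 1⊗1, the
tensor-product coalgebra structure makes it a bialgebra, and a⊗u ↦ (1⊗S(u))·(S(a)⊗1)
is an antipode for it.
-/

open TensorProduct Coalgebra LinearMap

noncomputable section

variable {k : Type} [Field k]

/-- Convolution product of linear maps from a coalgebra `C` to an algebra `M`:
`(f * g)(c) = Σ f(c₁) g(c₂)`. -/
def conv {C M : Type} [AddCommGroup C] [Module k C] [Coalgebra k C]
    [Ring M] [Algebra k M] (f g : C →ₗ[k] M) : C →ₗ[k] M :=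
  (LinearMap.mul' k M) ∘ₗ (TensorProduct.map f g) ∘ₗ Coalgebra.comul

/-- A skew pairing on the ordered pair `(A, U)`. -/
structure IsSkewPairing {A U : Type} [Ring A] [Ring U] [HopfAlgebra k A] [HopfAlgebra k U]
    (τ : A ⊗[k] U →ₗ[k] k) : Prop where
  mul_left : ∀ (b c : A) (u : U),
    τ ((b * c) ⊗ₜ u) = conv (τ ∘ₗ TensorProduct.mk k A U b) (τ ∘ₗ TensorProduct.mk k A U c) u
  mul_right : ∀ (b : A) (u v : U),
    τ (b ⊗ₜ (u * v)) =
      conv (τ ∘ₗ (TensorProduct.mk k A U).flip v) (τ ∘ₗ (TensorProduct.mk k A U).flip u) b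
  one_left : ∀ u : U, τ (1 ⊗ₜ u) = Coalgebra.counit u
  one_right : ∀ a : A, τ (a ⊗ₜ 1) = Coalgebra.counit a

variable {A U : Type} [Ring A] [Ring U] [HopfAlgebra k A] [HopfAlgebra k U]

/-- The linear map `A ⊗ U → A ⊗ U`, `b ⊗ u ↦ Σ τ(b₁,u₁) (b₂ ⊗ u₂) τ⁻¹(b₃,u₃)`,
expressed as a double convolution with the identity in the middle (the scalars act through
the algebra structure of `A ⊗ U`). -/
def doubleInner (τ τi : A ⊗[k] U →ₗ[k] k) : A ⊗[k] U →ₗ[k] A ⊗[k] U :=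
  conv (conv ((Algebra.linearMap k (A ⊗[k] U)) ∘ₗ τ) LinearMap.id)
    ((Algebra.linearMap k (A ⊗[k] U)) ∘ₗ τi)

section Hits

variable {C : Type} [AddCommGroup C] [Module k C] [Coalgebra k C]

/-- The operator `c ↦ Σ φ(c₁) c₂` on a coalgebra. -/
def leftHit : (C →ₗ[k] k) →ₗ[k] C →ₗ[k] C where
  toFun φ := (TensorProduct.lid k C).toLinearMap ∘ₗ φ.rTensor C ∘ₗ comul
  map_add' φ ψ := by ext; simp
  map_smul' r φ := by ext; simp

/-- The operator `c ↦ Σ c₁ ψ(c₂)` on a coalgebra. -/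
def rightHit : (C →ₗ[k] k) →ₗ[k] C →ₗ[k] C where
  toFun ψ := (TensorProduct.rid k C).toLinearMap ∘ₗ ψ.lTensor C ∘ₗ comul
  map_add' φ ψ := by ext; simp
  map_smul' r φ := by ext; simp

lemma leftHit_apply (φ : C →ₗ[k] k) (c : C) :
    leftHit φ c = TensorProduct.lid k C (φ.rTensor C (comul c)) := rfl

lemma rightHit_apply (ψ : C →ₗ[k] k) (c : C) :
    rightHit ψ c = TensorProduct.rid k C (ψ.lTensor C (comul c)) := rfl

lemma comul_leftHit (φ : C →ₗ[k] k) (c : C) :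
    comul (R := k) (leftHit φ c) = (leftHit φ).rTensor C (comul c) := by
  have h := congr(TensorProduct.lid k _ (φ.rTensor (C ⊗[k] C) $(coassoc_apply (R := k) c)))
  calc
    _ = TensorProduct.lid k _ (φ.rTensor (C ⊗[k] C) (comul.lTensor C (comul c))) := by
      rw [leftHit_apply]
      induction comul (R := k) c <;> simp_all
    _ = _ := by
      rw [← h]
      induction comul (R := k) c with
      | zero => simp
      | add _ _ h₁ h₂ => simp_all
      | tmul x y =>
        simp only [rTensor_tmul, leftHit_apply]
        induction comul (R := k) x <;> simp_all [TensorProduct.add_tmul, TensorProduct.smul_tmul']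

lemma comul_rightHit (ψ : C →ₗ[k] k) (c : C) :
    comul (R := k) (rightHit ψ c) = (rightHit ψ).lTensor C (comul c) := by
  have h := congr(TensorProduct.rid k _ (ψ.lTensor (C ⊗[k] C) $(coassoc_symm_apply (R := k) c)))
  calc
    _ = TensorProduct.rid k _ (ψ.lTensor (C ⊗[k] C) (comul.rTensor C (comul c))) := by
      rw [rightHit_apply]
      induction comul (R := k) c <;> simp_all
    _ = _ := by
      rw [← h]
      induction comul (R := k) c with
      | zero => simp
      | add _ _ h₁ h₂ => simp_all
      | tmul x y =>
        simp only [lTensor_tmul, rightHit_apply]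
        induction comul (R := k) y <;> simp_all [TensorProduct.tmul_add]

lemma rTensor_rightHit_comul (φ : C →ₗ[k] k) (c : C) :
    (rightHit φ).rTensor C (comul (R := k) c) = (leftHit φ).lTensor C (comul c) := by
  let F : C ⊗[k] (C ⊗[k] C) →ₗ[k] C ⊗[k] C :=
    ((TensorProduct.lid k C).toLinearMap ∘ₗ φ.rTensor C).lTensor C
  have h := congr(F $(coassoc_apply (R := k) c))
  calc
    _ = F (TensorProduct.assoc k C C C (comul.rTensor C (comul c))) := by
      induction comul (R := k) c with
      | zero => simp
      | add _ _ h₁ h₂ => simp_all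
      | tmul x y =>
        simp only [rTensor_tmul, rightHit_apply]
        induction comul (R := k) x <;>
          simp_all [F, TensorProduct.add_tmul, TensorProduct.smul_tmul]
    _ = _ := by
      rw [h]
      induction comul (R := k) c with
      | zero => simp
      | add _ _ h₁ h₂ => simp_all
      | tmul x y => simp [F, leftHit_apply]

lemma apply_leftHit (φ ψ : C →ₗ[k] k) (c : C) : ψ (leftHit φ c) = conv φ ψ c := by
  simp only [leftHit_apply, conv, coe_comp, Function.comp_apply]
  induction comul (R := k) c <;> simp_all

lemma apply_rightHit (φ ψ : C →ₗ[k] k) (c : C) : φ (rightHit ψ c) = conv φ ψ c := by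
  simp only [rightHit_apply, conv, coe_comp, Function.comp_apply]
  induction comul (R := k) c <;> simp_all [mul_comm]

lemma leftHit_leftHit (φ ψ : C →ₗ[k] k) (c : C) :
    leftHit ψ (leftHit φ c) = leftHit (conv φ ψ) c := by
  rw [leftHit_apply ψ, comul_leftHit, leftHit_apply (conv φ ψ)]
  induction comul (R := k) c <;> simp_all [apply_leftHit]

lemma rightHit_rightHit (φ ψ : C →ₗ[k] k) (c : C) :
    rightHit φ (rightHit ψ c) = rightHit (conv φ ψ) c := by
  rw [rightHit_apply φ, comul_rightHit, rightHit_apply (conv φ ψ)]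
  induction comul (R := k) c <;> simp_all [apply_rightHit]

lemma leftHit_rightHit (φ ψ : C →ₗ[k] k) (c : C) :
    leftHit φ (rightHit ψ c) = rightHit ψ (leftHit φ c) := by
  rw [leftHit_apply φ, comul_rightHit, leftHit_apply φ]
  induction comul (R := k) c <;> simp_all

@[simp]
lemma leftHit_counit (c : C) : leftHit (counit (R := k)) c = c := by
  simp [leftHit_apply]

@[simp]
lemma rightHit_counit (c : C) : rightHit (counit (R := k)) c = c := by
  simp [rightHit_apply]

/-- If `φ` is convolution inverse to `ψ`, then `c ↦ Σ φ(c₁) c₂ ψ(c₃)` is comultiplicative. -/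
lemma comul_leftHit_rightHit {φ ψ : C →ₗ[k] k} (h : conv ψ φ = counit) (c : C) :
    comul (R := k) (leftHit φ (rightHit ψ c)) =
      TensorProduct.map (leftHit φ ∘ₗ rightHit ψ) (leftHit φ ∘ₗ rightHit ψ) (comul c) := by
  have hid : (leftHit φ ∘ₗ leftHit ψ : C →ₗ[k] C) = LinearMap.id := by
    ext x; simp [leftHit_leftHit, h]
  have hcomm : leftHit φ ∘ₗ rightHit ψ = (rightHit ψ ∘ₗ leftHit φ : C →ₗ[k] C) := by
    ext x; simp [leftHit_rightHit]
  have key : TensorProduct.map (leftHit φ ∘ₗ rightHit ψ) (leftHit φ ∘ₗ rightHit ψ) (comul c) =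
      TensorProduct.map (leftHit φ) (rightHit ψ ∘ₗ leftHit φ)
        ((rightHit ψ).rTensor C (comul (R := k) c)) := by
    rw [hcomm, ← hcomm]
    induction comul (R := k) c <;> simp_all [leftHit_rightHit]
  rw [key, rTensor_rightHit_comul, comul_leftHit, comul_rightHit]
  induction comul (R := k) c with
  | zero => simp
  | add _ _ h₁ h₂ => simp_all
  | tmul x y => simp [leftHit_leftHit, h]

lemma counit_leftHit_rightHit {φ ψ : C →ₗ[k] k} (h : conv φ ψ = counit) (c : C) :
    counit (R := k) (leftHit φ (rightHit ψ c)) = counit (R := k) c := by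
  rw [leftHit_rightHit, apply_rightHit, ← apply_leftHit, leftHit_counit, apply_leftHit, h]

end Hits

section Antipode

variable {H : Type} [Ring H] [HopfAlgebra k H]

/-- The antipode is an anti-coalgebra map. -/
lemma comul_antipode (x : H) :
    comul (R := k) (HopfAlgebra.antipode k x) =
      TensorProduct.map (HopfAlgebra.antipode k) (HopfAlgebra.antipode k)
        (TensorProduct.comm k H H (comul x)) := by
  let S : H →ₗ[k] H := HopfAlgebra.antipode k
  let G : H →ₗ[k] H ⊗[k] H :=
    TensorProduct.map S S ∘ₗ (TensorProduct.comm k H H).toLinearMap ∘ₗ comul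
  let Δ : H →ₗ[k] H ⊗[k] H := comul
  suffices h : WithConv.toConv G * WithConv.toConv Δ = 1 by
    have h' := left_inv_eq_right_inv h LinearMap.comul_right_inv
    exact congr(WithConv.ofConv $h' x).symm
  ext c
  simp only [LinearMap.convMul_apply, LinearMap.convOne_apply]
  -- `Σ S(c₂)c₃ ⊗ S(c₁)c₄`, read off from `(Σ c₁ ⊗ (c₂ ⊗ c₃)) ⊗ c₄`
  let E : H ⊗[k] (H ⊗[k] H) →ₗ[k] H →ₗ[k] H ⊗[k] H :=
    TensorProduct.lift (LinearMap.mk₂ k (fun a w ↦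
      TensorProduct.mk k H H (LinearMap.mul' k H (S.rTensor H w)) ∘ₗ LinearMap.mul k H (S a))
      (by intros; ext; simp [TensorProduct.tmul_add])
      (by intros; ext; simp)
      (by intros; ext; simp)
      (by intros; ext; simp [TensorProduct.smul_tmul']))
  have hE (m q : H) : E (comul.lTensor H (comul m)) q = 1 ⊗ₜ (S m * q) := by
    have hm : m = TensorProduct.rid k H (counit.lTensor H (comul (R := k) m)) := by simp
    conv_rhs => rw [hm]
    induction comul (R := k) m with
    | zero => simp
    | add _ _ h₁ h₂ => simp_all [add_mul, TensorProduct.tmul_add]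
    | tmul a b => simp [E, S, Algebra.algebraMap_eq_smul_one]
  have hG (m q : H) : LinearMap.mul' k (H ⊗[k] H) (G.rTensor (H ⊗[k] H)
      (TensorProduct.assoc k H H H (comul (R := k) m ⊗ₜ q))) = 1 ⊗ₜ (S m * q) := by
    rw [← hE, ← coassoc_apply]
    induction comul (R := k) m with
    | zero => simp
    | add _ _ h₁ h₂ => simp_all [TensorProduct.add_tmul]
    | tmul a b =>
      simp only [TensorProduct.assoc_tmul, rTensor_tmul, G, coe_comp, Function.comp_apply,
        LinearEquiv.coe_coe]
      induction comul (R := k) a with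
      | zero => simp
      | add _ _ h₁ h₂ => simp_all [TensorProduct.add_tmul]
      | tmul x y => simp [E]
  calc
    _ = LinearMap.mul' k (H ⊗[k] H) (G.rTensor (H ⊗[k] H) (comul.lTensor H (comul c))) := by
      congr 1
      induction comul (R := k) c <;> simp_all [Δ]
    _ = 1 ⊗ₜ LinearMap.mul' k H (S.rTensor H (comul c)) := by
      rw [← coassoc_apply]
      induction comul (R := k) c with
      | zero => simp
      | add _ _ h₁ h₂ => simp_all [TensorProduct.tmul_add]
      | tmul m q => simp [hG]
    _ = _ := by
      simp [S, Algebra.algebraMap_eq_smul_one, Algebra.TensorProduct.one_def,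
        TensorProduct.smul_tmul']

end Antipode

section TwistedTensor

/-- `mulD` is the multiplication of the twisted tensor product `A ⊗ U` with exchange map `R`, where
`R` is compatible with the units and the multiplications of `A` and `U`. -/
structure IsTwistedMul (R : A ⊗[k] U →ₗ[k] A ⊗[k] U)
    (mulD : (A ⊗[k] U) ⊗[k] (A ⊗[k] U) →ₗ[k] A ⊗[k] U) : Prop where
  tmul_tmul : ∀ (a b : A) (u v : U),
    mulD ((a ⊗ₜ u) ⊗ₜ (b ⊗ₜ v)) = (a ⊗ₜ (1 : U)) * R (b ⊗ₜ u) * ((1 : A) ⊗ₜ v)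
  one_left : ∀ u : U, R (1 ⊗ₜ u) = 1 ⊗ₜ u
  one_right : ∀ b : A, R (b ⊗ₜ 1) = b ⊗ₜ 1
  mul_left : ∀ (b c : A) (u : U), R ((b * c) ⊗ₜ u) = mulD (R (b ⊗ₜ u) ⊗ₜ (c ⊗ₜ 1))
  mul_right : ∀ (b : A) (u v : U), R (b ⊗ₜ (u * v)) = mulD ((1 ⊗ₜ u) ⊗ₜ R (b ⊗ₜ v))

namespace IsTwistedMul

variable {R : A ⊗[k] U →ₗ[k] A ⊗[k] U} {mulD : (A ⊗[k] U) ⊗[k] (A ⊗[k] U) →ₗ[k] A ⊗[k] U}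

lemma mul_tmul_one_tmul (h : IsTwistedMul R mulD) (a : A) (x y : A ⊗[k] U) :
    mulD (((a ⊗ₜ 1) * x) ⊗ₜ y) = (a ⊗ₜ 1) * mulD (x ⊗ₜ y) := by
  induction x with
  | zero => simp
  | add _ _ h₁ h₂ => simp_all [mul_add, TensorProduct.add_tmul]
  | tmul b u =>
    induction y with
    | zero => simp
    | add _ _ h₁ h₂ => simp_all [mul_add, TensorProduct.tmul_add]
    | tmul c v => simp [h.tmul_tmul, ← mul_assoc]

lemma tmul_mul_one_tmul (h : IsTwistedMul R mulD) (v : U) (x y : A ⊗[k] U) :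
    mulD (x ⊗ₜ (y * (1 ⊗ₜ v))) = mulD (x ⊗ₜ y) * (1 ⊗ₜ v) := by
  induction x with
  | zero => simp
  | add _ _ h₁ h₂ => simp_all [add_mul, TensorProduct.add_tmul]
  | tmul b u =>
    induction y with
    | zero => simp
    | add _ _ h₁ h₂ => simp_all [add_mul, TensorProduct.tmul_add]
    | tmul c v => simp [h.tmul_tmul, mul_assoc]

lemma tmul_one_tmul (h : IsTwistedMul R mulD) (a u v) :
    mulD ((a ⊗ₜ u) ⊗ₜ (1 ⊗ₜ v)) = a ⊗ₜ (u * v) := by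
  simp [h.tmul_tmul, h.one_left]

lemma tmul_tmul_of_one (h : IsTwistedMul R mulD) (a b v) :
    mulD ((a ⊗ₜ 1) ⊗ₜ (b ⊗ₜ v)) = (a * b) ⊗ₜ v := by
  simp [h.tmul_tmul, h.one_right]

lemma exchange_right (h : IsTwistedMul R mulD) (x : A ⊗[k] U) (c : A) (v : U) :
    mulD ((x * (1 ⊗ₜ v)) ⊗ₜ (c ⊗ₜ 1)) = mulD (x ⊗ₜ R (c ⊗ₜ v)) := by
  induction x with
  | zero => simp
  | add _ _ h₁ h₂ => simp_all [add_mul, TensorProduct.add_tmul]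
  | tmul b u =>
    have hb : b ⊗ₜ[k] u = (b ⊗ₜ 1) * (1 ⊗ₜ u) := by simp
    rw [hb, mul_assoc, h.mul_tmul_one_tmul, h.mul_tmul_one_tmul, ← h.mul_right]
    simp [h.tmul_tmul, ← Algebra.TensorProduct.one_def]

lemma exchange_left (h : IsTwistedMul R mulD) (x : A ⊗[k] U) (b : A) (u : U) :
    mulD ((1 ⊗ₜ u) ⊗ₜ ((b ⊗ₜ 1) * x)) = mulD (R (b ⊗ₜ u) ⊗ₜ x) := by
  induction x with
  | zero => simp
  | add _ _ h₁ h₂ => simp_all [mul_add, TensorProduct.tmul_add]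
  | tmul c v =>
    have hc : c ⊗ₜ[k] v = (c ⊗ₜ 1) * (1 ⊗ₜ v) := by simp
    rw [hc, ← mul_assoc, h.tmul_mul_one_tmul, h.tmul_mul_one_tmul, ← h.mul_left]
    simp [h.tmul_tmul, ← Algebra.TensorProduct.one_def]

lemma assoc (h : IsTwistedMul R mulD) (x y z : A ⊗[k] U) :
    mulD (mulD (x ⊗ₜ y) ⊗ₜ z) = mulD (x ⊗ₜ mulD (y ⊗ₜ z)) := by
  induction x with
  | zero => simp
  | add _ _ h₁ h₂ => simp_all [TensorProduct.add_tmul]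
  | tmul a u =>
  induction y with
  | zero => simp
  | add _ _ h₁ h₂ => simp_all [TensorProduct.add_tmul, TensorProduct.tmul_add]
  | tmul b v =>
  induction z with
  | zero => simp
  | add _ _ h₁ h₂ => simp_all [TensorProduct.tmul_add]
  | tmul c w =>
    have ha : a ⊗ₜ[k] u = (a ⊗ₜ 1) * (1 ⊗ₜ u) := by simp
    have hc : c ⊗ₜ[k] w = (c ⊗ₜ 1) * (1 ⊗ₜ w) := by simp
    rw [h.tmul_tmul a, h.tmul_tmul b, h.tmul_mul_one_tmul, mul_assoc, h.mul_tmul_one_tmul, hc,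
      h.tmul_mul_one_tmul, h.exchange_right, ha, h.mul_tmul_one_tmul, h.exchange_left, mul_assoc]

lemma comul_mul (h : IsTwistedMul R mulD)
    (hR : ∀ x, comul (R := k) (R x) = TensorProduct.map R R (comul x)) (x y : A ⊗[k] U) :
    comul (R := k) (mulD (x ⊗ₜ y)) =
      (TensorProduct.map mulD mulD ∘ₗ
        (TensorProduct.tensorTensorTensorComm k (A ⊗[k] U) (A ⊗[k] U)
          (A ⊗[k] U) (A ⊗[k] U)).toLinearMap) (comul (R := k) x ⊗ₜ comul (R := k) y) := by
  induction x with
  | zero => simp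
  | add _ _ h₁ h₂ => simp_all [TensorProduct.add_tmul]
  | tmul a u =>
  induction y with
  | zero => simp
  | add _ _ h₁ h₂ => simp_all [TensorProduct.tmul_add]
  | tmul b v =>
    rw [h.tmul_tmul, Bialgebra.comul_mul, Bialgebra.comul_mul, hR]
    simp only [TensorProduct.comul_tmul, Bialgebra.comul_one]
    induction comul (R := k) a with
    | zero => simp
    | add _ _ h₁ h₂ => simp_all [TensorProduct.add_tmul, add_mul]
    | tmul a₁ a₂ =>
    induction comul (R := k) v with
    | zero => simp
    | add _ _ h₁ h₂ => simp_all [TensorProduct.tmul_add, mul_add]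
    | tmul v₁ v₂ =>
    induction comul (R := k) b with
    | zero => simp
    | add _ _ h₁ h₂ => simp_all [TensorProduct.tmul_add, TensorProduct.add_tmul, mul_add, add_mul]
    | tmul b₁ b₂ =>
    induction comul (R := k) u with
    | zero => simp
    | add _ _ h₁ h₂ => simp_all [TensorProduct.tmul_add, TensorProduct.add_tmul, mul_add, add_mul]
    | tmul u₁ u₂ => simp [h.tmul_tmul, Algebra.TensorProduct.one_def]

lemma counit_mul (h : IsTwistedMul R mulD)
    (hR : ∀ x, counit (R := k) (R x) = counit (R := k) x) (x y : A ⊗[k] U) :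
    counit (R := k) (mulD (x ⊗ₜ y)) = counit (R := k) x * counit (R := k) y := by
  induction x with
  | zero => simp
  | add _ _ h₁ h₂ => simp_all [TensorProduct.add_tmul, add_mul]
  | tmul a u =>
  induction y with
  | zero => simp
  | add _ _ h₁ h₂ => simp_all [TensorProduct.tmul_add, mul_add]
  | tmul b v =>
    rw [h.tmul_tmul, Bialgebra.counit_mul, Bialgebra.counit_mul, hR]
    simp
    ring

variable (mulD) in
/-- The map `a ⊗ u ↦ (1 ⊗ S(u)) · (S(a) ⊗ 1)`, with the product given by `mulD`. -/
def twistedAntipode : A ⊗[k] U →ₗ[k] A ⊗[k] U :=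
  mulD ∘ₗ
    TensorProduct.map
      ((TensorProduct.mk k A U 1) ∘ₗ HopfAlgebra.antipode (R := k))
      (((TensorProduct.mk k A U).flip 1) ∘ₗ HopfAlgebra.antipode (R := k))
    ∘ₗ (TensorProduct.comm k A U).toLinearMap

lemma twistedAntipode_mul_id (h : IsTwistedMul R mulD) :
    mulD ∘ₗ TensorProduct.map (twistedAntipode mulD) LinearMap.id ∘ₗ comul =
      Algebra.linearMap k (A ⊗[k] U) ∘ₗ counit := by
  have hA (α : A ⊗[k] A) (u₁ u₂ : U) :
      mulD (TensorProduct.map (twistedAntipode mulD) LinearMap.id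
        (AlgebraTensorModule.tensorTensorTensorComm k k k k A A U U (α ⊗ₜ (u₁ ⊗ₜ u₂)))) =
      mulD ((1 ⊗ₜ HopfAlgebra.antipode k u₁) ⊗ₜ
        (LinearMap.mul' k A ((HopfAlgebra.antipode k).rTensor A α) ⊗ₜ u₂)) := by
    induction α with
    | zero => simp
    | add _ _ h₁ h₂ => simp_all [TensorProduct.add_tmul, TensorProduct.tmul_add]
    | tmul a₁ a₂ => simp [twistedAntipode, h.assoc, h.tmul_tmul_of_one]
  have hU (a : A) (w : U ⊗[k] U) :
      mulD (TensorProduct.map (twistedAntipode mulD) LinearMap.id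
        (AlgebraTensorModule.tensorTensorTensorComm k k k k A A U U (comul a ⊗ₜ w))) =
      counit (R := k) a • (1 ⊗ₜ LinearMap.mul' k U ((HopfAlgebra.antipode k).rTensor U w)) := by
    induction w with
    | zero => simp
    | add _ _ h₁ h₂ => simp_all [TensorProduct.tmul_add]
    | tmul u₁ u₂ =>
      simp [hA, HopfAlgebra.mul_antipode_rTensor_comul_apply, Algebra.algebraMap_eq_smul_one,
        ← TensorProduct.smul_tmul', h.tmul_one_tmul]
  ext a u
  simp [TensorProduct.comul_tmul, hU, HopfAlgebra.mul_antipode_rTensor_comul_apply,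
    Algebra.algebraMap_eq_smul_one, Algebra.TensorProduct.one_def, smul_smul, mul_comm]

lemma id_mul_twistedAntipode (h : IsTwistedMul R mulD) :
    mulD ∘ₗ TensorProduct.map LinearMap.id (twistedAntipode mulD) ∘ₗ comul =
      Algebra.linearMap k (A ⊗[k] U) ∘ₗ counit := by
  have hU (w : U ⊗[k] U) (a₁ a₂ : A) :
      mulD (TensorProduct.map LinearMap.id (twistedAntipode mulD)
        (AlgebraTensorModule.tensorTensorTensorComm k k k k A A U U ((a₁ ⊗ₜ a₂) ⊗ₜ w))) =
      mulD ((a₁ ⊗ₜ LinearMap.mul' k U ((HopfAlgebra.antipode k).lTensor U w)) ⊗ₜ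
        (HopfAlgebra.antipode k a₂ ⊗ₜ 1)) := by
    induction w with
    | zero => simp
    | add _ _ h₁ h₂ => simp_all [TensorProduct.add_tmul, TensorProduct.tmul_add]
    | tmul u₁ u₂ => simp [twistedAntipode, ← h.assoc, h.tmul_one_tmul]
  have hA (u : U) (α : A ⊗[k] A) :
      mulD (TensorProduct.map LinearMap.id (twistedAntipode mulD)
        (AlgebraTensorModule.tensorTensorTensorComm k k k k A A U U (α ⊗ₜ comul u))) =
      counit (R := k) u • (LinearMap.mul' k A ((HopfAlgebra.antipode k).lTensor A α) ⊗ₜ 1) := by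
    induction α with
    | zero => simp
    | add _ _ h₁ h₂ => simp_all [TensorProduct.add_tmul]
    | tmul a₁ a₂ =>
      simp [hU, HopfAlgebra.mul_antipode_lTensor_comul_apply, Algebra.algebraMap_eq_smul_one,
        ← TensorProduct.smul_tmul', h.tmul_tmul_of_one]
  ext a u
  simp [TensorProduct.comul_tmul, hA, HopfAlgebra.mul_antipode_lTensor_comul_apply,
    Algebra.algebraMap_eq_smul_one, Algebra.TensorProduct.one_def, ← TensorProduct.smul_tmul',
    smul_smul, mul_comm]

end IsTwistedMul

end TwistedTensor

section Sandwich

variable {X Y M : Type} [AddCommGroup X] [Module k X] [AddCommGroup Y] [Module k Y]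
  [AddCommGroup M] [Module k M]

/-- The linear map with `(x ⊗ y) ⊗ z ↦ m y ∘ P x ∘ Q z`. -/
def sandwich (m : X →ₗ[k] Y →ₗ[k] M) (P Q : X →ₗ[k] Y →ₗ[k] Y) :
    (X ⊗[k] X) ⊗[k] X →ₗ[k] Y →ₗ[k] M :=
  TensorProduct.lift (TensorProduct.lift (LinearMap.mk₂ k
    (fun x y ↦ LinearMap.llcomp k Y Y M (m y ∘ₗ P x) ∘ₗ Q)
    (by intros; ext; simp) (by intros; ext; simp) (by intros; ext; simp) (by intros; ext; simp)))

@[simp]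
lemma sandwich_tmul (m : X →ₗ[k] Y →ₗ[k] M) (P Q : X →ₗ[k] Y →ₗ[k] Y) (x y z : X) (t : Y) :
    sandwich m P Q ((x ⊗ₜ y) ⊗ₜ z) t = m y (P x (Q z t)) := by
  simp [sandwich]

end Sandwich

section Pairing

lemma doubleInner_apply (τ τi : A ⊗[k] U →ₗ[k] k) (x : A ⊗[k] U) :
    doubleInner τ τi x = leftHit τ (rightHit τi x) := by
  have hleft (y : A ⊗[k] U) :
      conv (Algebra.linearMap k (A ⊗[k] U) ∘ₗ τ) LinearMap.id y = leftHit τ y := by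
    simp only [leftHit_apply, conv, coe_comp, Function.comp_apply]
    induction comul (R := k) y with
    | zero => simp
    | add _ _ h₁ h₂ => simp_all
    | tmul => simp [Algebra.smul_def]
  rw [leftHit_rightHit, rightHit_apply, comul_leftHit, doubleInner, conv]
  simp only [coe_comp, Function.comp_apply]
  induction comul (R := k) x with
  | zero => simp
  | add _ _ h₁ h₂ => simp_all
  | tmul _ y =>
    have hc := Algebra.commutes (R := k) (A := A ⊗[k] U) (τi y)
    simp_all [Algebra.smul_def]

lemma leftHit_rightHit_tmul (τ τi : A ⊗[k] U →ₗ[k] k) (b : A) (u : U) :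
    leftHit τ (rightHit τi (b ⊗ₜ u)) =
      sandwich (TensorProduct.mk k A U) (leftHit ∘ₗ curry τ) (rightHit ∘ₗ curry τi)
        (comul.rTensor A (comul b)) u := by
  have hleft (x : A) (v : U) : leftHit τ (x ⊗ₜ v) =
      TensorProduct.lift (LinearMap.mk₂ k
        (fun x₁ x₂ ↦ x₂ ⊗ₜ[k] leftHit (curry τ x₁) v)
        (by simp [TensorProduct.tmul_add]) (by simp)
        (by simp [TensorProduct.add_tmul]) (by simp [TensorProduct.smul_tmul'])) (comul x) := by
    rw [leftHit_apply, TensorProduct.comul_tmul]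
    induction comul (R := k) x with
    | zero => simp
    | add _ _ h₁ h₂ => simp_all [TensorProduct.add_tmul]
    | tmul x₁ x₂ =>
      simp only [lift.tmul, mk₂_apply, leftHit_apply]
      induction comul (R := k) v <;> simp_all [TensorProduct.tmul_add]
  rw [rightHit_apply, TensorProduct.comul_tmul]
  induction comul (R := k) b with
  | zero => simp
  | add _ _ h₁ h₂ => simp_all [TensorProduct.add_tmul]
  | tmul x z =>
    trans leftHit τ (x ⊗ₜ rightHit (curry τi z) u)
    · congr 1
      rw [rightHit_apply]
      induction comul (R := k) u <;> simp_all [TensorProduct.tmul_add]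
    · rw [hleft, rTensor_tmul]
      induction comul (R := k) x with
      | zero => simp
      | add _ _ h₁ h₂ => simp_all [TensorProduct.add_tmul]
      | tmul => simp only [lift.tmul, sandwich_tmul]; rfl

lemma leftHit_rightHit_tmul' (τ τi : A ⊗[k] U →ₗ[k] k) (b : A) (u : U) :
    leftHit τ (rightHit τi (b ⊗ₜ u)) =
      sandwich (TensorProduct.mk k A U).flip (leftHit ∘ₗ (curry τ).flip)
        (rightHit ∘ₗ (curry τi).flip) (comul.rTensor U (comul u)) b := by
  have hleft (a : A) (x : U) : leftHit τ (a ⊗ₜ x) =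
      TensorProduct.lift (LinearMap.mk₂ k
        (fun x₁ x₂ ↦ leftHit ((curry τ).flip x₁) a ⊗ₜ[k] x₂)
        (by simp [TensorProduct.add_tmul]) (by simp [TensorProduct.smul_tmul'])
        (by simp [TensorProduct.tmul_add]) (by simp)) (comul x) := by
    rw [leftHit_apply, TensorProduct.comul_tmul]
    induction comul (R := k) x with
    | zero => simp
    | add _ _ h₁ h₂ => simp_all [TensorProduct.tmul_add]
    | tmul x₁ x₂ =>
      simp only [lift.tmul, mk₂_apply, leftHit_apply]
      induction comul (R := k) a <;>
        simp_all [TensorProduct.add_tmul, TensorProduct.smul_tmul']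
  rw [rightHit_apply, TensorProduct.comul_tmul]
  induction comul (R := k) u with
  | zero => simp
  | add _ _ h₁ h₂ => simp_all [TensorProduct.tmul_add]
  | tmul x z =>
    trans leftHit τ (rightHit ((curry τi).flip z) b ⊗ₜ x)
    · congr 1
      rw [rightHit_apply]
      induction comul (R := k) b <;>
        simp_all [TensorProduct.add_tmul, TensorProduct.smul_tmul']
    · rw [hleft, rTensor_tmul]
      induction comul (R := k) x with
      | zero => simp
      | add _ _ h₁ h₂ => simp_all [TensorProduct.add_tmul]
      | tmul => simp only [lift.tmul, sandwich_tmul]; rfl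

lemma rTensor_comul_mul {B : Type} [Ring B] [Bialgebra k B] (x y : B ⊗[k] B) :
    comul.rTensor B (x * y) = comul.rTensor B x * comul.rTensor B y :=
  map_mul (Algebra.TensorProduct.map (Bialgebra.comulAlgHom k B) (AlgHom.id k B)) x y

/-- The form `(a, u) ↦ τ(S(a), u)`. -/
def invPairing (τ : A ⊗[k] U →ₗ[k] k) : A ⊗[k] U →ₗ[k] k :=
  τ ∘ₗ TensorProduct.map (HopfAlgebra.antipode (R := k)) LinearMap.id

namespace IsSkewPairing

variable {τ : A ⊗[k] U →ₗ[k] k}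

lemma curry_mul (hτ : IsSkewPairing τ) (b c : A) :
    curry τ (b * c) = conv (curry τ b) (curry τ c) :=
  LinearMap.ext (hτ.mul_left b c)

lemma curry_one (hτ : IsSkewPairing τ) : curry τ 1 = counit :=
  LinearMap.ext hτ.one_left

lemma flip_mul (hτ : IsSkewPairing τ) (u v : U) :
    (curry τ).flip (u * v) = conv ((curry τ).flip v) ((curry τ).flip u) :=
  LinearMap.ext fun b ↦ hτ.mul_right b u v

lemma flip_one (hτ : IsSkewPairing τ) : (curry τ).flip 1 = counit :=
  LinearMap.ext hτ.one_right

lemma curry_inv (τ : A ⊗[k] U →ₗ[k] k) (b : A) :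
    curry (invPairing τ) b = curry τ (HopfAlgebra.antipode k b) := rfl

lemma inv_curry_mul (hτ : IsSkewPairing τ) (b c : A) :
    curry (invPairing τ) (b * c) = conv (curry (invPairing τ) c) (curry (invPairing τ) b) := by
  simp only [curry_inv, HopfAlgebra.antipode_mul_antidistrib, hτ.curry_mul]

lemma inv_curry_one (hτ : IsSkewPairing τ) : curry (invPairing τ) 1 = counit := by
  rw [curry_inv, HopfAlgebra.antipode_one, hτ.curry_one]

lemma inv_flip_mul (hτ : IsSkewPairing τ) (u v : U) :
    (curry (invPairing τ)).flip (u * v) =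
      conv ((curry (invPairing τ)).flip u) ((curry (invPairing τ)).flip v) := by
  ext b
  trans conv ((curry τ).flip v) ((curry τ).flip u) (HopfAlgebra.antipode k b)
  · rw [← hτ.flip_mul]; rfl
  · simp only [conv, coe_comp, Function.comp_apply, comul_antipode]
    induction comul (R := k) b with
    | zero => simp
    | add _ _ h₁ h₂ => simp_all
    | tmul => simp [curry_inv, mul_comm]

lemma inv_flip_one (hτ : IsSkewPairing τ) : (curry (invPairing τ)).flip 1 = counit := by
  ext b
  simp [curry_inv, hτ.one_right]

end IsSkewPairing

/-- The exchange map of the quantum double satisfies the axioms of a twisted tensor product. -/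
lemma IsSkewPairing.isTwistedMul {τ : A ⊗[k] U →ₗ[k] k} (hτ : IsSkewPairing τ)
    {mulD : (A ⊗[k] U) ⊗[k] (A ⊗[k] U) →ₗ[k] A ⊗[k] U}
    (h : ∀ (a b : A) (u v : U), mulD ((a ⊗ₜ u) ⊗ₜ (b ⊗ₜ v)) =
      (a ⊗ₜ (1 : U)) * leftHit τ (rightHit (invPairing τ) (b ⊗ₜ u)) * ((1 : A) ⊗ₜ v)) :
    IsTwistedMul (leftHit τ ∘ₗ rightHit (invPairing τ)) mulD where
  tmul_tmul := h
  one_left u := by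
    simp [leftHit_rightHit_tmul, Algebra.TensorProduct.one_def, hτ.curry_one, hτ.inv_curry_one]
  one_right b := by
    simp [leftHit_rightHit_tmul', Algebra.TensorProduct.one_def, hτ.flip_one, hτ.inv_flip_one]
  mul_left b c u := by
    rw [coe_comp, Function.comp_apply, Function.comp_apply, leftHit_rightHit_tmul,
      leftHit_rightHit_tmul, Bialgebra.comul_mul, rTensor_comul_mul]
    induction comul.rTensor A (comul (R := k) b) with
    | zero => simp
    | add _ _ h₁ h₂ => simp_all [TensorProduct.add_tmul, add_mul]
    | tmul β z =>
    induction β with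
    | zero => simp
    | add _ _ h₁ h₂ => simp_all [TensorProduct.add_tmul, add_mul]
    | tmul x y =>
    rw [sandwich_tmul, TensorProduct.mk_apply, h, leftHit_rightHit_tmul,
      ← Algebra.TensorProduct.one_def, mul_one]
    induction comul.rTensor A (comul (R := k) c) with
    | zero => simp
    | add _ _ h₁ h₂ => simp_all [mul_add]
    | tmul γ z' =>
    induction γ with
    | zero => simp
    | add _ _ h₁ h₂ => simp_all [TensorProduct.add_tmul, mul_add]
    | tmul x' y' =>
      simp [hτ.curry_mul, hτ.inv_curry_mul, ← leftHit_leftHit, ← rightHit_rightHit,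
        leftHit_rightHit]
  mul_right b u v := by
    rw [coe_comp, Function.comp_apply, Function.comp_apply, leftHit_rightHit_tmul',
      leftHit_rightHit_tmul', Bialgebra.comul_mul, rTensor_comul_mul]
    induction comul.rTensor U (comul (R := k) v) with
    | zero => simp
    | add _ _ h₁ h₂ => simp_all [TensorProduct.tmul_add, mul_add]
    | tmul γ z =>
    induction γ with
    | zero => simp
    | add _ _ h₁ h₂ => simp_all [TensorProduct.add_tmul, TensorProduct.tmul_add, mul_add]
    | tmul x y =>
    rw [sandwich_tmul, flip_apply, TensorProduct.mk_apply, h, leftHit_rightHit_tmul',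
      ← Algebra.TensorProduct.one_def, one_mul]
    induction comul.rTensor U (comul (R := k) u) with
    | zero => simp
    | add _ _ h₁ h₂ => simp_all [add_mul]
    | tmul β z' =>
    induction β with
    | zero => simp
    | add _ _ h₁ h₂ => simp_all [TensorProduct.add_tmul, add_mul]
    | tmul x' y' =>
      simp [hτ.flip_mul, hτ.inv_flip_mul, ← leftHit_leftHit, ← rightHit_rightHit,
        leftHit_rightHit]

end Pairing

theorem quantumDouble_isHopfAlgebra (τ : A ⊗[k] U →ₗ[k] k) (hτ : IsSkewPairing τ)
    -- τ⁻¹(a,u) = τ(S(a),u)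
    (τi : A ⊗[k] U →ₗ[k] k)
    (hτi : τi = τ ∘ₗ TensorProduct.map (HopfAlgebra.antipode (R := k)) LinearMap.id)
    -- τ is invertible with convolution inverse τ⁻¹
    (hinv₁ : conv τ τi = Coalgebra.counit) (hinv₂ : conv τi τ = Coalgebra.counit)
    -- the quantum double multiplication:
    -- (a⊗u)(b⊗v) = Σ τ(b₁,u₁) ab₂ ⊗ u₂v τ⁻¹(b₃,u₃)
    (mulD : (A ⊗[k] U) ⊗[k] (A ⊗[k] U) →ₗ[k] A ⊗[k] U)
    (hmulD : ∀ (a b : A) (u v : U),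
      mulD ((a ⊗ₜ u) ⊗ₜ (b ⊗ₜ v))
        = (a ⊗ₜ (1 : U)) * doubleInner τ τi (b ⊗ₜ u) * ((1 : A) ⊗ₜ v)) :
    -- the multiplication is associative
    (∀ x y z : A ⊗[k] U, mulD (mulD (x ⊗ₜ y) ⊗ₜ z) = mulD (x ⊗ₜ mulD (y ⊗ₜ z))) ∧
    -- with unit 1 ⊗ 1
    (∀ x : A ⊗[k] U, mulD ((((1 : A) ⊗ₜ (1 : U)) : A ⊗[k] U) ⊗ₜ x) = x
      ∧ mulD (x ⊗ₜ (((1 : A) ⊗ₜ (1 : U)) : A ⊗[k] U)) = x) ∧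
    -- the tensor-product coalgebra structure makes it a bialgebra:
    -- Δ is multiplicative,
    (∀ x y : A ⊗[k] U,
      Coalgebra.comul (R := k) (mulD (x ⊗ₜ y))
        = ((TensorProduct.map mulD mulD) ∘ₗ
            (TensorProduct.tensorTensorTensorComm k (A ⊗[k] U) (A ⊗[k] U)
              (A ⊗[k] U) (A ⊗[k] U)).toLinearMap)
          ((Coalgebra.comul (R := k) x) ⊗ₜ (Coalgebra.comul (R := k) y))) ∧
    -- ε is multiplicative,
    (∀ x y : A ⊗[k] U,
      Coalgebra.counit (R := k) (mulD (x ⊗ₜ y))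
        = Coalgebra.counit (R := k) x * Coalgebra.counit (R := k) y) ∧
    -- Δ and ε preserve the unit,
    (Coalgebra.comul (R := k) (((1 : A) ⊗ₜ (1 : U)) : A ⊗[k] U)
        = (((1 : A) ⊗ₜ (1 : U)) : A ⊗[k] U) ⊗ₜ (((1 : A) ⊗ₜ (1 : U)) : A ⊗[k] U)) ∧
    (Coalgebra.counit (R := k) (((1 : A) ⊗ₜ (1 : U)) : A ⊗[k] U) = 1) ∧
    -- and a ⊗ u ↦ (1 ⊗ S(u))·(S(a) ⊗ 1) is an antipode
    (mulD ∘ₗ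
        TensorProduct.map
          (mulD ∘ₗ
            TensorProduct.map
              ((TensorProduct.mk k A U 1) ∘ₗ HopfAlgebra.antipode (R := k))
              (((TensorProduct.mk k A U).flip 1) ∘ₗ HopfAlgebra.antipode (R := k))
            ∘ₗ (TensorProduct.comm k A U).toLinearMap)
          LinearMap.id
        ∘ₗ Coalgebra.comul
      = Algebra.linearMap k (A ⊗[k] U) ∘ₗ Coalgebra.counit) ∧
    (mulD ∘ₗ
        TensorProduct.map
          LinearMap.id
          (mulD ∘ₗ
            TensorProduct.map
              ((TensorProduct.mk k A U 1) ∘ₗ HopfAlgebra.antipode (R := k))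
              (((TensorProduct.mk k A U).flip 1) ∘ₗ HopfAlgebra.antipode (R := k))
            ∘ₗ (TensorProduct.comm k A U).toLinearMap)
        ∘ₗ Coalgebra.comul
      = Algebra.linearMap k (A ⊗[k] U) ∘ₗ Coalgebra.counit) := by
  subst hτi
  change conv τ (invPairing τ) = _ at hinv₁
  change conv (invPairing τ) τ = _ at hinv₂
  have h : IsTwistedMul (leftHit τ ∘ₗ rightHit (invPairing τ)) mulD :=
    hτ.isTwistedMul fun a b u v ↦ by rw [hmulD, ← doubleInner_apply]; rfl
  refine ⟨h.assoc, fun x ↦ ⟨?_, ?_⟩, h.comul_mul (comul_leftHit_rightHit hinv₂),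
    h.counit_mul (counit_leftHit_rightHit hinv₁), ?_, ?_, h.twistedAntipode_mul_id,
    h.id_mul_twistedAntipode⟩
  · induction x with
    | zero => simp
    | add _ _ h₁ h₂ => simp_all [TensorProduct.tmul_add]
    | tmul a u => simp [h.tmul_tmul_of_one]
  · induction x with
    | zero => simp
    | add _ _ h₁ h₂ => simp_all [TensorProduct.add_tmul]
    | tmul a u => simp [h.tmul_one_tmul]
  · exact Bialgebra.comul_one (R := k) (A := A ⊗[k] U)
  · exact Bialgebra.counit_one (R := k) (A := A ⊗[k] U)

end
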